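/- Let V be a real symmetric positive definite matrix partitioned into blocks corresponding to three subsystems A, B, C. Then the Schur complement of the combined BC-block in V is less than or equal, in the Loewner (positive semidefinite) order, to the Schur complement of the C-block in the principal submatrix V_{AC}: V/V_{BC} ≤ V_{AC}/V_C (both are matrices on subsystem A). -/

import Mathlib

open Matrix
open scoped ComplexOrder Kronecker

noncomputable section

/-- The standard symplectic form on a single mode. -/
def J2 : Matrix (Fin 2) (Fin 2) ℝ := !![0, 1; -1, 0]

/-- The standard symplectic form on `n` modes: the direct sum of `n` copies of
`[[0,1],[-1,0]]`, realized on the index type `Fin n × Fin 2`. -/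
def Omega (n : ℕ) : Matrix (Fin n × Fin 2) (Fin n × Fin 2) ℝ :=
  (1 : Matrix (Fin n) (Fin n) ℝ) ⊗ₖ J2

/-- `V` is a quantum covariance matrix with respect to the symplectic form `Om`:
the complex matrix `V + i·Om` is positive semidefinite. -/
def QCM {ι : Type*} [Fintype ι] (Om V : Matrix ι ι ℝ) : Prop :=
  (V.map Complex.ofReal + Complex.I • Om.map Complex.ofReal).PosSemidef

/-- The positive semidefinite square root of a positive semidefinite real matrix
(junk value `0` if the matrix is not positive semidefinite). -/
def msqrt {ι : Type*} [Fintype ι] [DecidableEq ι] (A : Matrix ι ι ℝ) : Matrix ι ι ℝ := by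
  classical exact if h : A.PosSemidef then
    (h.1.eigenvectorUnitary : Matrix ι ι ℝ) * diagonal (Real.sqrt ∘ h.1.eigenvalues) *
      (star h.1.eigenvectorUnitary : Matrix ι ι ℝ) else 0

/-- `g₋(A) = Σ_i max(−log ν_i, 0)` where `ν_1, …, ν_n` are the symplectic eigenvalues of `A`
(w.r.t. the symplectic form `Om`), i.e. the eigenvalues of the Hermitian matrix
`i·√A·Om·√A` are exactly `±ν_1, …, ±ν_n`; equivalently, half the sum of
`max(−log |λ|, 0)` over all eigenvalues `λ` of `i·√A·Om·√A`. -/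
def gMinus {ι : Type*} [Fintype ι] [DecidableEq ι] (Om A : Matrix ι ι ℝ) : ℝ := by
  classical exact
    if h : (Complex.I • ((msqrt A * Om * msqrt A).map Complex.ofReal)).IsHermitian then
      (∑ j, max (-Real.log |h.eigenvalues j|) 0) / 2
    else 0

/-- `g₊(A) = Σ_i max(log ν_i, 0)` where `ν_1, …, ν_n` are the symplectic eigenvalues of `A`
(w.r.t. the symplectic form `Om`). -/
def gPlus {ι : Type*} [Fintype ι] [DecidableEq ι] (Om A : Matrix ι ι ℝ) : ℝ := by
  classical exact
    if h : (Complex.I • ((msqrt A * Om * msqrt A).map Complex.ofReal)).IsHermitian then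
      (∑ j, max (Real.log |h.eigenvalues j|) 0) / 2
    else 0

/-- Schur complement of the first (upper-left) diagonal block of a block matrix:
`M/M₁₁ = M₂₂ − M₂₁ M₁₁⁻¹ M₁₂`. -/
def schurA {a b : Type*} [Fintype a] [DecidableEq a]
    (M : Matrix (a ⊕ b) (a ⊕ b) ℝ) : Matrix b b ℝ :=
  M.toBlocks₂₂ - M.toBlocks₂₁ * M.toBlocks₁₁⁻¹ * M.toBlocks₁₂

/-- Schur complement of the second (lower-right) diagonal block of a block matrix:
`M/M₂₂ = M₁₁ − M₁₂ M₂₂⁻¹ M₂₁`. -/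
def schurB {a b : Type*} [Fintype b] [DecidableEq b]
    (M : Matrix (a ⊕ b) (a ⊕ b) ℝ) : Matrix a a ℝ :=
  M.toBlocks₁₁ - M.toBlocks₁₂ * M.toBlocks₂₂⁻¹ * M.toBlocks₂₁

/-- Embedding of the `A ⊕ C` indices into `A ⊕ (B ⊕ C)`. -/
def embAC {a b c : Type*} : a ⊕ c → a ⊕ (b ⊕ c) :=
  Sum.elim Sum.inl (Sum.inr ∘ Sum.inr)

/-- Embedding of the `A ⊕ B` indices into `A ⊕ (B ⊕ C)`. -/
def embAB {a b c : Type*} : a ⊕ b → a ⊕ (b ⊕ c) :=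
  Sum.elim Sum.inl (Sum.inr ∘ Sum.inl)


/-- **Theorem 1 (Partial trace in the denominator increases Schur complement).**
For a real symmetric positive definite tripartite matrix `V` on `A ⊕ (B ⊕ C)`,
`V/V_{BC} ≤ V_{AC}/V_C` in the Loewner order. -/
theorem partial_trace_increases_schur (nA nB nC : ℕ)
    (V : Matrix ((Fin nA × Fin 2) ⊕ ((Fin nB × Fin 2) ⊕ (Fin nC × Fin 2)))
        ((Fin nA × Fin 2) ⊕ ((Fin nB × Fin 2) ⊕ (Fin nC × Fin 2))) ℝ)
    (hVsymm : V.IsSymm) (hVpd : V.PosDef) :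
    (schurB (V.submatrix (embAC (b := Fin nB × Fin 2)) (embAC (b := Fin nB × Fin 2)))
      - schurB V).PosSemidef := by
  have hH : ∀ i j, V i j = V j i := fun i j => (hVsymm.apply i j).symm
  have hD : V.toBlocks₂₂.PosDef := hVpd.submatrix (e := Sum.inr) Sum.inr_injective
  have hC : (V.toBlocks₂₂.toBlocks₂₂).PosDef :=
    hD.submatrix (e := Sum.inr) Sum.inr_injective
  let _ : Invertible V.toBlocks₂₂ := hD.isUnit.invertible
  let _ : Invertible V.toBlocks₂₂.toBlocks₂₂ := hC.isUnit.invertible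
  have hB : V.toBlocks₂₁ = V.toBlocks₁₂ᴴ := by
    ext i j
    simp [toBlocks₂₁, toBlocks₁₂, hH (Sum.inr i)]
  -- subtracting `V / V_BC` from the `A` block leaves a positive semidefinite matrix
  have h1 : (fromBlocks (V.toBlocks₁₁ - schurB V) V.toBlocks₁₂ V.toBlocks₁₂ᴴ
      V.toBlocks₂₂).PosSemidef := by
    rw [PosDef.fromBlocks₂₂ _ _ hD]
    have : V.toBlocks₁₁ - schurB V - V.toBlocks₁₂ * V.toBlocks₂₂⁻¹ * V.toBlocks₁₂ᴴ = 0 := by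
      rw [schurB, hB]; abel
    rw [this]
    exact PosSemidef.zero
  -- restrict to the `A ⊕ C` block and use the Schur complement criterion again
  have h2 := h1.submatrix (embAC (b := Fin nB × Fin 2))
  set X : Matrix (Fin nA × Fin 2) (Fin nC × Fin 2) ℝ :=
    of fun i j => V (Sum.inl i) (Sum.inr (Sum.inr j)) with hX
  have h3 : (fromBlocks (V.toBlocks₁₁ - schurB V) X Xᴴ
      V.toBlocks₂₂.toBlocks₂₂).PosSemidef := by
    convert h2 using 1
    ext i j
    rcases i with i | i <;> rcases j with j | j <;>
      simp [embAC, hX, toBlocks₁₂, toBlocks₂₂]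
  rw [PosDef.fromBlocks₂₂ _ _ hC] at h3
  have e21 : (V.submatrix (embAC (b := Fin nB × Fin 2))
      (embAC (b := Fin nB × Fin 2))).toBlocks₂₁ = Xᴴ := by
    ext i j
    simp [toBlocks₂₁, embAC, hX, hH (Sum.inr (Sum.inr i))]
  have e : schurB (V.submatrix (embAC (b := Fin nB × Fin 2)) (embAC (b := Fin nB × Fin 2)))
      = V.toBlocks₁₁ - X * V.toBlocks₂₂.toBlocks₂₂⁻¹ * Xᴴ := by
    rw [schurB, e21]
    rfl
  rw [e, sub_right_comm]
  exact h3

end
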